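/- Let n ≥ 1, let μ ∈ ℤⁿ with μ₁ ≥ … ≥ μₙ ≥ 0, let T⁰_μ be the highest weight tableau of shape μ (all entries of row i equal i), let ℓ ≥ ℓ(μ) (the length of the first column of μ), and let F ∈ B(ϖ_ℓ) be a column such that F ⊗ T⁰_μ is semistandard. Then Ψ_{F⊗T⁰_μ} = t^{ℓ(u_F)} (T_{u_F⁻¹})⁻¹ 1_{ϖ_ℓ+μ}. In particular, for every dominant λ ∈ ℤⁿ_{≥0}, Ψ_{T⁰_λ} = 1_λ. -/

import Mathlib

set_option maxHeartbeats 1000000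

attribute [local instance] Classical.propDecidable

noncomputable section

namespace HLHecke

/-- The base ring `ℤ[t^{±1}]` of Laurent polynomials. -/
abbrev HR : Type := LaurentPolynomial ℤ

/-- The parameter `t`. -/
def tt : HR := LaurentPolynomial.T 1

/-! ### The symmetric group on `Fin n` -/

/-- The simple transposition `s_j = (j, j+1)` (junk value `1` if out of range). -/
def sgen (n : ℕ) (j : ℕ) : Equiv.Perm (Fin n) :=
  if h : j + 1 < n then Equiv.swap ⟨j, Nat.lt_of_succ_lt h⟩ ⟨j + 1, h⟩ else 1

/-- The product `s_{i₁} ⋯ s_{i_ℓ}` of a word `l = [i₁, …, i_ℓ]`. -/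
def wordProd (n : ℕ) (l : List ℕ) : Equiv.Perm (Fin n) := (l.map (sgen n)).prod

/-- The action of `S_n` on `ℤⁿ` by permutation of coordinates. -/
def wAct (n : ℕ) (w : Equiv.Perm (Fin n)) (μ : Fin n → ℤ) : Fin n → ℤ := fun i => μ (w⁻¹ i)

/-- The standard inner product on `ℤⁿ`. -/
def ip (n : ℕ) (μ ν : Fin n → ℤ) : ℤ := ∑ i, μ i * ν i

/-- The standard basis vector `ε_i`. -/
def eps (n : ℕ) (i : Fin n) : Fin n → ℤ := fun k => if k = i then 1 else 0

/-- The simple root `α_j = ε_j − ε_{j+1}` (0-indexed: entries `j` and `j+1` of `Fin n`). -/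
def alpha (n : ℕ) (j : ℕ) : Fin n → ℤ :=
  fun i => if (i : ℕ) = j then 1 else if (i : ℕ) = j + 1 then -1 else 0

/-- The fundamental weight `ϖ_k = ε₁ + … + ε_k`. -/
def varpi (n : ℕ) (k : ℕ) : Fin n → ℤ := fun i => if (i : ℕ) < k then 1 else 0

/-- The set of positive roots `R₊`. -/
def Rpos (n : ℕ) (β : Fin n → ℤ) : Prop := ∃ i j : Fin n, i < j ∧ β = eps n i - eps n j

/-- The Coxeter length: minimal length of a word in the simple transpositions. -/
def len (n : ℕ) (w : Equiv.Perm (Fin n)) : ℕ :=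
  sInf {k | ∃ l : List ℕ, (∀ j ∈ l, j + 1 < n) ∧ l.length = k ∧ wordProd n l = w}

/-- A choice of reduced word for `w`. -/
def redWord (n : ℕ) (w : Equiv.Perm (Fin n)) : List ℕ :=
  if h : ∃ l : List ℕ, (∀ j ∈ l, j + 1 < n) ∧ l.length = len n w ∧ wordProd n l = w
  then h.choose else []

/-! ### Columns -/

lemma col_card_le (n : ℕ) (C : Finset (Fin n)) : C.card ≤ n := by
  simpa using Finset.card_le_univ C

/-- The minimal length coset representative `u_C` attached to a column `C`:
it sends `1, …, ℓ` to the entries of `C` in increasing order and `ℓ+1, …, n` to the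
entries of the complement of `C` in increasing order. -/
def colPerm (n : ℕ) (C : Finset (Fin n)) : Equiv.Perm (Fin n) :=
  ((finCongr ((Nat.add_sub_cancel' (col_card_le n C)).symm)).trans
    finSumFinEquiv.symm).trans <|
  ((Equiv.sumCongr (C.orderIsoOfFin rfl).toEquiv
      ((Cᶜ.orderIsoOfFin (by simp [Finset.card_compl])).toEquiv)).trans <|
    (Equiv.sumCongr (Equiv.refl _) (Equiv.subtypeEquivRight (fun x => Finset.mem_compl))).trans
      (Equiv.sumCompl (fun x => x ∈ C)))

/-- The `k`-th smallest entry of a column (0-indexed, as a natural number; junk `0` if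
out of range). -/
def nth (n : ℕ) (C : Finset (Fin n)) (k : ℕ) : ℕ := ((C.sort (· ≤ ·)).map Fin.val).getD k 0

/-- The action of the simple transposition `s_j` on columns. -/
def sCol (n : ℕ) (j : ℕ) (C : Finset (Fin n)) : Finset (Fin n) := C.image (sgen n j)

/-- Semistandardness of the two-column filling `F ⊗ E` (`F` the left column):
entrywise `f_i ≤ e_i`. -/
def pairSS (n : ℕ) (F E : Finset (Fin n)) : Prop := ∀ k < E.card, nth n F k ≤ nth n E k

/-- A filling by columns (leftmost column first) is semistandard iff all adjacent pairs are. -/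
def isSSYT (n : ℕ) (L : List (Finset (Fin n))) : Prop := L.Chain' (pairSS n)

/-- The set `B(ϖ_ℓ)` of columns of length `ℓ`. -/
def colFinset (n : ℕ) (ℓ : ℕ) : Finset (Finset (Fin n)) := Finset.univ.filter fun C => C.card = ℓ

/-- The highest weight column `(1, …, k)`. -/
def hwCol (n : ℕ) (k : ℕ) : Finset (Fin n) := Finset.univ.filter fun x => (x : ℕ) < k

/-- The vector `⃗C ∈ ℤⁿ` attached to a column `C`. -/
def vecOf (n : ℕ) (C : Finset (Fin n)) : Fin n → ℤ := fun i => if i ∈ C then 1 else 0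

/-- The sign `σ^j_C`: `-1` if `j ∈ C` and `j+1 ∉ C`, and `+1` otherwise. -/
def sigmaSign (n : ℕ) (j : ℕ) (C : Finset (Fin n)) : ℤ :=
  if h : j + 1 < n then
    (if (⟨j, Nat.lt_of_succ_lt h⟩ : Fin n) ∈ C ∧ (⟨j + 1, h⟩ : Fin n) ∉ C then -1 else 1)
  else 1

/-! ### Shapes and tableaux -/

/-- The length `λ'_{j+1}` of the `(j+1)`-st column (0-indexed `j`) of the Young diagram
of a partition `λ`. -/
def shapeColLen (n : ℕ) (μ : Fin n → ℤ) (j : ℕ) : ℕ :=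
  (Finset.univ.filter fun i : Fin n => (j : ℤ) < μ i).card

/-- The number of columns of the Young diagram of a dominant weight. -/
def numCols (n : ℕ) (μ : Fin n → ℤ) : ℕ := Finset.univ.sup fun i : Fin n => (μ i).toNat

/-- The highest weight tableau `T⁰_μ`: row `i` is filled with `i`, i.e. its columns are the
highest weight columns. -/
def hwTableau (n : ℕ) (μ : Fin n → ℤ) : List (Finset (Fin n)) :=
  List.ofFn fun j : Fin (numCols n μ) => hwCol n (shapeColLen n μ (j : ℕ))

/-- The content vector of a tableau: `(wtVec T) i` is the number of entries equal to `i`. -/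
def wtVec (n : ℕ) (L : List (Finset (Fin n))) : Fin n → ℤ :=
  fun i => ((L.filter fun C => i ∈ C).length : ℤ)

/-! ### Macdonald's ψ statistic -/

/-- Number of entries `≤ i` in the column at position `p` (0-indexed from the left). -/
def colCount (n : ℕ) (L : List (Finset (Fin n))) (i p : ℕ) : ℕ :=
  ((L.getD p ∅).filter fun x => (x : ℕ) < i).card

/-- The factor `ψ_{T_{≤ i+1}/T_{≤ i}}` of Macdonald's ψ. -/
def stripFactor (n : ℕ) (L : List (Finset (Fin n))) (i : ℕ) : HR :=
  ∏ p ∈ Finset.range L.length,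
    if colCount n L (i + 1) p = colCount n L i p ∧
        colCount n L (i + 1) (p + 1) = colCount n L i (p + 1) + 1 then
      1 - tt ^ (colCount n L i p - colCount n L i (p + 1))
    else 1

/-- Macdonald's `ψ_T = ∏_{i=1}^{n-1} ψ_{T_{≤ i+1}/T_{≤ i}}` for a semistandard tableau. -/
def macPsi (n : ℕ) (L : List (Finset (Fin n))) : HR := ∏ i ∈ Finset.Ico 1 n, stripFactor n L i

/-- Macdonald's tableau statistic, extended by `0` to non-semistandard fillings. -/
def psiT (n : ℕ) (L : List (Finset (Fin n))) : HR := if isSSYT n L then macPsi n L else 0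

/-! ### The affine Hecke algebra -/

/-- Generators of the affine Hecke algebra. -/
inductive AGen (n : ℕ) : Type
  | T : ℕ → AGen n
  | X : Fin n → AGen n
  | Xinv : Fin n → AGen n

/-- The free algebra on the generators. -/
abbrev FA (n : ℕ) := FreeAlgebra HR (AGen n)

def fT (n : ℕ) (j : ℕ) : FA n := FreeAlgebra.ι HR (AGen.T j)
def fX (n : ℕ) (i : Fin n) : FA n := FreeAlgebra.ι HR (AGen.X i)
def fXi (n : ℕ) (i : Fin n) : FA n := FreeAlgebra.ι HR (AGen.Xinv i)

/-- The defining relations of the type `GL_n` affine Hecke algebra. -/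
inductive ARel (n : ℕ) : FA n → FA n → Prop
  | junk (j : ℕ) (h : ¬ j + 1 < n) : ARel n (fT n j) 1
  | quad (j : ℕ) (h : j + 1 < n) :
      ARel n (fT n j * fT n j) ((tt - 1) • fT n j + algebraMap HR (FA n) tt)
  | braid (j : ℕ) (h : j + 2 < n) :
      ARel n (fT n j * fT n (j + 1) * fT n j) (fT n (j + 1) * fT n j * fT n (j + 1))
  | commT (j k : ℕ) (hjk : j + 1 < k) (hk : k + 1 < n) :
      ARel n (fT n j * fT n k) (fT n k * fT n j)
  | commX (i i' : Fin n) : ARel n (fX n i * fX n i') (fX n i' * fX n i)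
  | XinvL (i : Fin n) : ARel n (fX n i * fXi n i) 1
  | XinvR (i : Fin n) : ARel n (fXi n i * fX n i) 1
  | TXT (j : ℕ) (h : j + 1 < n) :
      ARel n (fT n j * fX n ⟨j, Nat.lt_of_succ_lt h⟩ * fT n j) (tt • fX n ⟨j + 1, h⟩)
  | TXcomm (j : ℕ) (h : j + 1 < n) (i : Fin n) (hi1 : (i : ℕ) ≠ j) (hi2 : (i : ℕ) ≠ j + 1) :
      ARel n (fT n j * fX n i) (fX n i * fT n j)

/-- The type `GL_n` affine Hecke algebra. -/
abbrev H (n : ℕ) := RingQuot (ARel n)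

/-- The generator `T_j` of the (affine) Hecke algebra. -/
def Tg (n : ℕ) (j : ℕ) : H n := RingQuot.mkAlgHom HR (ARel n) (fT n j)

/-- The generator `X_i`. -/
def Xg (n : ℕ) (i : Fin n) : H n := RingQuot.mkAlgHom HR (ARel n) (fX n i)

/-- The generator `X_i⁻¹`. -/
def Xig (n : ℕ) (i : Fin n) : H n := RingQuot.mkAlgHom HR (ARel n) (fXi n i)

/-- The scalar `t` inside `H`. -/
def tH (n : ℕ) : H n := algebraMap HR (H n) tt

/-- The scalar `t^k` inside `H`. -/
def tpow (n : ℕ) (k : ℕ) : H n := algebraMap HR (H n) (tt ^ k)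

/-- The monomial `X^μ` for `μ ∈ ℤⁿ`. -/
def Xmon (n : ℕ) (μ : Fin n → ℤ) : H n :=
  (List.ofFn fun i : Fin n =>
    if 0 ≤ μ i then Xg n i ^ (μ i).toNat else Xig n i ^ (-μ i).toNat).prod

/-- The product `T_{i₁} ⋯ T_{i_ℓ}` of a word. -/
def TofWord (n : ℕ) (l : List ℕ) : H n := (l.map (Tg n)).prod

/-- The element `T_w`, defined via a choice of reduced word for `w`. -/
def Tw (n : ℕ) (w : Equiv.Perm (Fin n)) : H n := TofWord n (redWord n w)

/-- The finite Hecke symmetrizer `1₀ = Σ_{w ∈ S_n} T_w`. -/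
def one0 (n : ℕ) : H n := ∑ w : Equiv.Perm (Fin n), Tw n w

/-- The stabilizer `S_{n,λ}` as a finset. -/
def stabFinset (n : ℕ) (lam : Fin n → ℤ) : Finset (Equiv.Perm (Fin n)) :=
  Finset.univ.filter fun w => wAct n w lam = lam

/-- The parabolic symmetrizer `1_λ = Σ_{w ∈ S_{n,λ}} T_w`. -/
def onePara (n : ℕ) (lam : Fin n → ℤ) : H n := ∑ w ∈ stabFinset n lam, Tw n w

/-- The Poincaré polynomial `W_λ(t) = Σ_{w ∈ S_{n,λ}} t^{ℓ(w)}`. -/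
def Wlam (n : ℕ) (lam : Fin n → ℤ) : HR := ∑ w ∈ stabFinset n lam, tt ^ len n w

/-- The parabolic subalgebra `H_{n,λ}`, as the span of `{T_w : w ∈ S_{n,λ}}`. -/
def HparaM (n : ℕ) (lam : Fin n → ℤ) : Submodule HR (H n) :=
  Submodule.span HR (Tw n '' {w | wAct n w lam = lam})

/-- The finite Hecke algebra `H_n`, the subalgebra generated by the `T_j`. -/
def Hfin (n : ℕ) : Subalgebra HR (H n) := Algebra.adjoin HR (Set.range (Tg n))

/-- The coefficient `h_{C, S}` of the parabolic decomposition
`h = Σ_{F ∈ B(ϖ_ℓ)} T_{u_F} h_F` (defined via choice; it is unique). -/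
def paraCoeff (n : ℕ) (ℓ : ℕ) (h : H n) (C : Finset (Fin n)) : H n :=
  if hex : ∃ g : Finset (Fin n) → H n,
      (∀ F : Finset (Fin n), F.card = ℓ → g F ∈ HparaM n (varpi n ℓ)) ∧
      h = ∑ F ∈ colFinset n ℓ, Tw n (colPerm n F) * g F
  then hex.choose C else 0

/-- The elements `Ψ_T` of the finite Hecke algebra, defined by recursion on the columns of `T`
(leftmost column first).  By convention `Ψ` of the empty tableau is `1₀`. -/
def Psi (n : ℕ) : List (Finset (Fin n)) → H n
  | [] => one0 n
  | [C] => tpow n (len n (colPerm n C)) * Ring.inverse (Tw n (colPerm n C)⁻¹) *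
      onePara n (varpi n C.card)
  | C :: S => tpow n (len n (colPerm n C)) * Ring.inverse (Tw n (colPerm n C)⁻¹) *
      paraCoeff n C.card (Psi n S) C

end HLHecke
namespace HLHecke

open Equiv in
lemma sgen_pos {n j : ℕ} (h : j + 1 < n) :
    sgen n j = Equiv.swap ⟨j, Nat.lt_of_succ_lt h⟩ ⟨j + 1, h⟩ := dif_pos h

lemma sgen_mul_self (n j : ℕ) : sgen n j * sgen n j = 1 := by
  unfold sgen
  split_ifs
  · exact Equiv.swap_mul_self _ _
  · simp

lemma sgen_inv (n j : ℕ) : (sgen n j)⁻¹ = sgen n j :=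
  inv_eq_of_mul_eq_one_left (sgen_mul_self n j)

lemma sgen_mul_cancel (n j : ℕ) (w : Equiv.Perm (Fin n)) : sgen n j * (sgen n j * w) = w := by
  rw [← mul_assoc, sgen_mul_self, one_mul]

lemma mul_sgen_cancel (n j : ℕ) (w : Equiv.Perm (Fin n)) : w * sgen n j * sgen n j = w := by
  rw [mul_assoc, sgen_mul_self, mul_one]

lemma sgen_l {n j : ℕ} (h : j + 1 < n) :
    sgen n j ⟨j, Nat.lt_of_succ_lt h⟩ = ⟨j + 1, h⟩ := by
  rw [sgen_pos h, Equiv.swap_apply_left]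

lemma sgen_r {n j : ℕ} (h : j + 1 < n) :
    sgen n j ⟨j + 1, h⟩ = ⟨j, Nat.lt_of_succ_lt h⟩ := by
  rw [sgen_pos h, Equiv.swap_apply_right]

lemma sgen_o {n j : ℕ} (i : Fin n) (h1 : (i : ℕ) ≠ j) (h2 : (i : ℕ) ≠ j + 1) :
    sgen n j i = i := by
  unfold sgen
  split_ifs with h
  · apply Equiv.swap_apply_of_ne_of_ne <;> intro h <;> simp [h] at h1 h2
  · simp

/-- number of inversions -/
def ninv (n : ℕ) (f : Equiv.Perm (Fin n)) : ℕ :=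
  (Finset.univ.filter fun p : Fin n × Fin n => p.1 < p.2 ∧ f p.2 < f p.1).card

lemma ninv_up {n j : ℕ} (h : j + 1 < n) (f : Equiv.Perm (Fin n))
    (hf : f ⟨j, Nat.lt_of_succ_lt h⟩ < f ⟨j + 1, h⟩) :
    ninv n (f * sgen n j) = ninv n f + 1 := by
  have key : (Finset.univ.filter fun p : Fin n × Fin n =>
        p.1 < p.2 ∧ (f * sgen n j) p.2 < (f * sgen n j) p.1) =
      insert ((⟨j, Nat.lt_of_succ_lt h⟩ : Fin n), (⟨j + 1, h⟩ : Fin n))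
      ((Finset.univ.filter fun p : Fin n × Fin n => p.1 < p.2 ∧ f p.2 < f p.1).map
        (Equiv.prodCongr (sgen n j) (sgen n j)).toEmbedding) := by
    ext ⟨a, b⟩
    have e : (Equiv.prodCongr (sgen n j) (sgen n j)).symm (a, b) = (sgen n j a, sgen n j b) := by
      have : (sgen n j).symm = sgen n j := sgen_inv n j
      simp [this]
    rw [Finset.mem_insert, Finset.mem_map_equiv, e, Finset.mem_filter, Finset.mem_filter]
    simp only [Finset.mem_univ, true_and, Equiv.Perm.mul_apply, Prod.mk.injEq]
    have hs : ∀ x : Fin n, (x = ⟨j, Nat.lt_of_succ_lt h⟩ ∧ sgen n j x = ⟨j + 1, h⟩) ∨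
        (x = ⟨j + 1, h⟩ ∧ sgen n j x = ⟨j, Nat.lt_of_succ_lt h⟩) ∨
        ((x : ℕ) ≠ j ∧ (x : ℕ) ≠ j + 1 ∧ sgen n j x = x) := by
      intro x
      by_cases h1 : (x : ℕ) = j
      · left
        have : x = ⟨j, Nat.lt_of_succ_lt h⟩ := Fin.ext h1
        exact ⟨this, by rw [this, sgen_l h]⟩
      by_cases h2 : (x : ℕ) = j + 1
      · right; left
        have : x = ⟨j + 1, h⟩ := Fin.ext h2
        exact ⟨this, by rw [this, sgen_r h]⟩
      · right; right
        exact ⟨h1, h2, sgen_o x h1 h2⟩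
    have hfl := Fin.lt_def.mp hf
    rcases hs a with ⟨rfl, ha'⟩ | ⟨rfl, ha'⟩ | ⟨ha, ha1, ha'⟩ <;>
    rcases hs b with ⟨rfl, hb'⟩ | ⟨rfl, hb'⟩ | ⟨hb, hb1, hb'⟩ <;>
    simp only [ha', hb'] <;> clear ha' hb' hs e <;> simp only [Fin.lt_def, Fin.ext_iff, true_and, and_true, true_or, iff_true] <;>
    omega
  unfold ninv
  rw [key, Finset.card_insert_of_notMem, Finset.card_map]
  rw [Finset.mem_map_equiv]
  have : (sgen n j).symm = sgen n j := sgen_inv n j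
  simp [this, sgen_l h, sgen_r h]

lemma ninv_down {n j : ℕ} (h : j + 1 < n) (f : Equiv.Perm (Fin n))
    (hf : f ⟨j + 1, h⟩ < f ⟨j, Nat.lt_of_succ_lt h⟩) :
    ninv n (f * sgen n j) + 1 = ninv n f := by
  have := ninv_up h (f * sgen n j) (by simpa [sgen_l h, sgen_r h] using hf)
  rw [mul_sgen_cancel] at this
  exact this.symm

lemma ne_adj {n j : ℕ} (h : j + 1 < n) (f : Equiv.Perm (Fin n)) :
    f ⟨j + 1, h⟩ < f ⟨j, Nat.lt_of_succ_lt h⟩ ∨ f ⟨j, Nat.lt_of_succ_lt h⟩ < f ⟨j + 1, h⟩ := by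
  apply lt_or_gt_of_ne
  intro e
  have := f.injective e
  simp at this

lemma ninv_one (n : ℕ) : ninv n 1 = 0 := by
  unfold ninv
  rw [Finset.card_eq_zero, Finset.filter_eq_empty_iff]
  rintro ⟨a, b⟩ - ⟨h1, h2⟩
  exact absurd h1 (by simpa using h2.le)

lemma eq_one_of_no_descent {n : ℕ} (f : Equiv.Perm (Fin n))
    (hf : ∀ j (h : j + 1 < n), f ⟨j, Nat.lt_of_succ_lt h⟩ < f ⟨j + 1, h⟩) : f = 1 := by
  have hm : StrictMono f := by
    cases n with
    | zero => intro a; exact a.elim0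
    | succ n =>
      rw [Fin.strictMono_iff_lt_succ]
      intro i
      exact hf i (by omega)
  have := (hm.range_inj (strictMono_id)).mp (by simp [f.surjective.range_eq])
  ext i
  simp [this]

lemma exists_descent {n : ℕ} (f : Equiv.Perm (Fin n)) (hf : f ≠ 1) :
    ∃ j, ∃ h : j + 1 < n, f ⟨j + 1, h⟩ < f ⟨j, Nat.lt_of_succ_lt h⟩ := by
  by_contra hc
  push Not at hc
  exact hf (eq_one_of_no_descent f fun j h => (ne_adj h f).resolve_left (not_lt.mpr (hc j h)))

lemma wordProd_cons (n j : ℕ) (l : List ℕ) : wordProd n (j :: l) = sgen n j * wordProd n l := by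
  simp [wordProd]

lemma wordProd_inv_cons (n j : ℕ) (l : List ℕ) :
    (wordProd n (j :: l))⁻¹ = (wordProd n l)⁻¹ * sgen n j := by
  rw [wordProd_cons, mul_inv_rev, sgen_inv]

lemma TofWord_cons (n j : ℕ) (l : List ℕ) : TofWord n (j :: l) = Tg n j * TofWord n l := by
  simp [TofWord]

lemma ninv_word_le (n : ℕ) (l : List ℕ) (hl : ∀ j ∈ l, j + 1 < n) :
    ninv n (wordProd n l)⁻¹ ≤ l.length := by
  induction l with
  | nil => simp [wordProd, ninv_one]
  | cons j l ih =>
    have h := hl j (by simp)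
    have ih := ih fun k hk => hl k (by simp [hk])
    rw [wordProd_inv_cons, List.length_cons]
    rcases ne_adj h (wordProd n l)⁻¹ with h1 | h1
    · have := ninv_down h _ h1
      omega
    · have := ninv_up h _ h1
      omega

/-- reduced words -/
def Red (n : ℕ) (l : List ℕ) : Prop :=
  (∀ j ∈ l, j + 1 < n) ∧ ninv n (wordProd n l)⁻¹ = l.length

lemma exists_red (n : ℕ) : ∀ (k : ℕ) (w : Equiv.Perm (Fin n)), ninv n w⁻¹ = k →
    ∃ l, Red n l ∧ wordProd n l = w := by
  intro k
  induction k with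
  | zero =>
    intro w hw
    refine ⟨[], ⟨by simp, by simp [wordProd, ninv_one]⟩, ?_⟩
    by_contra hne
    have : w⁻¹ ≠ 1 := by
      intro h
      rw [inv_eq_one] at h
      exact hne (by simp [wordProd, h])
    obtain ⟨j, h, hd⟩ := exists_descent _ this
    have := ninv_down h _ hd
    omega
  | succ k ih =>
    intro w hw
    have : w⁻¹ ≠ 1 := by
      intro h
      rw [h, ninv_one] at hw
      omega
    obtain ⟨j, h, hd⟩ := exists_descent _ this
    have h2 := ninv_down h _ hd
    obtain ⟨l, hl, hw'⟩ := ih (sgen n j * w) (by rw [mul_inv_rev, sgen_inv]; omega)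
    have e : wordProd n (j :: l) = w := by rw [wordProd_cons, hw', sgen_mul_cancel]
    refine ⟨j :: l, ⟨?_, ?_⟩, e⟩
    · intro i hi
      rcases List.mem_cons.mp hi with rfl | hi
      · exact h
      · exact hl.1 i hi
    · rw [e, hw, List.length_cons]
      have := hl.2
      rw [hw', mul_inv_rev, sgen_inv] at this
      omega

lemma len_eq (n : ℕ) (w : Equiv.Perm (Fin n)) : len n w = ninv n w⁻¹ := by
  obtain ⟨l, hl, hw⟩ := exists_red n _ w rfl
  unfold len
  apply le_antisymm
  · apply Nat.sInf_le
    exact ⟨l, hl.1, by rw [← hl.2, hw], hw⟩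
  · apply le_csInf
    · exact ⟨_, l, hl.1, rfl, hw⟩
    · rintro k ⟨l', h1, rfl, rfl⟩
      exact ninv_word_le n l' h1

lemma redWord_spec (n : ℕ) (w : Equiv.Perm (Fin n)) :
    Red n (redWord n w) ∧ wordProd n (redWord n w) = w := by
  have h : ∃ l : List ℕ, (∀ j ∈ l, j + 1 < n) ∧ l.length = len n w ∧ wordProd n l = w := by
    obtain ⟨l, hl, hw⟩ := exists_red n _ w rfl
    exact ⟨l, hl.1, by rw [len_eq, ← hl.2, hw], hw⟩
  have e : redWord n w = h.choose := dif_pos h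
  obtain ⟨h1, h2, h3⟩ := h.choose_spec
  rw [← e] at h1 h2 h3
  exact ⟨⟨h1, by rw [h3, h2, len_eq]⟩, h3⟩

lemma ninv_inv_le (n : ℕ) (w : Equiv.Perm (Fin n)) : ninv n w ≤ ninv n w⁻¹ := by
  obtain ⟨l, hl, hw⟩ := exists_red n _ w rfl
  have e : wordProd n l.reverse = w⁻¹ := by
    rw [← hw, wordProd, wordProd, List.prod_inv_reverse, List.map_reverse, List.map_map]
    congr 2
    apply List.map_congr_left
    intro j _
    exact (sgen_inv n j).symm
  have := ninv_word_le n l.reverse (by simpa using hl.1)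
  rw [e, inv_inv, List.length_reverse, ← hl.2, hw] at this
  exact this

lemma ninv_inv (n : ℕ) (w : Equiv.Perm (Fin n)) : ninv n w⁻¹ = ninv n w :=
  le_antisymm (by simpa using ninv_inv_le n w⁻¹) (ninv_inv_le n w)

lemma red_cons {n j : ℕ} {l : List ℕ} (hr : Red n (j :: l)) :
    ∃ h : j + 1 < n, Red n l ∧
      (wordProd n l)⁻¹ ⟨j, Nat.lt_of_succ_lt h⟩ < (wordProd n l)⁻¹ ⟨j + 1, h⟩ := by
  obtain ⟨h1, h2⟩ := hr
  have h := h1 j (by simp)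
  have h3 : ∀ k ∈ l, k + 1 < n := fun k hk => h1 k (by simp [hk])
  have h4 := ninv_word_le n l h3
  rw [wordProd_inv_cons, List.length_cons] at h2
  rcases ne_adj h (wordProd n l)⁻¹ with h5 | h5
  · have := ninv_down h _ h5
    omega
  · have := ninv_up h _ h5
    exact ⟨h, ⟨h3, by omega⟩, h5⟩

lemma red_cons' {n j : ℕ} {l : List ℕ} (h : j + 1 < n) (hr : Red n l)
    (hd : (wordProd n l)⁻¹ ⟨j, Nat.lt_of_succ_lt h⟩ < (wordProd n l)⁻¹ ⟨j + 1, h⟩) :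
    Red n (j :: l) := by
  refine ⟨?_, ?_⟩
  · intro i hi
    rcases List.mem_cons.mp hi with rfl | hi
    · exact h
    · exact hr.1 i hi
  · rw [wordProd_inv_cons, ninv_up h _ hd, hr.2, List.length_cons]

lemma Tg_quad {n j : ℕ} (h : j + 1 < n) :
    Tg n j * Tg n j = (tt - 1) • Tg n j + algebraMap HR (H n) tt := by
  have := RingQuot.mkAlgHom_rel HR (ARel.quad (n := n) j h)
  simpa [Tg] using this

lemma Tg_braid {n j : ℕ} (h : j + 2 < n) :
    Tg n j * Tg n (j + 1) * Tg n j = Tg n (j + 1) * Tg n j * Tg n (j + 1) := by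
  have := RingQuot.mkAlgHom_rel HR (ARel.braid (n := n) j h)
  simpa [Tg] using this

lemma Tg_comm {n j k : ℕ} (h : j + 1 < k) (hk : k + 1 < n) :
    Tg n j * Tg n k = Tg n k * Tg n j := by
  have := RingQuot.mkAlgHom_rel HR (ARel.commT (n := n) j k h hk)
  simpa [Tg] using this

lemma sgen_comm {n j k : ℕ} (h : j + 1 < k) (hk : k + 1 < n) :
    sgen n j * sgen n k = sgen n k * sgen n j := by
  have hj : j + 1 < n := by omega
  rw [sgen_pos hj, sgen_pos hk]
  apply Equiv.Perm.Disjoint.commute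
  apply Equiv.Perm.disjoint_swap_swap
  simp
  omega

lemma sgen_braid {n j : ℕ} (h : j + 2 < n) :
    sgen n j * sgen n (j + 1) * sgen n j = sgen n (j + 1) * sgen n j * sgen n (j + 1) := by
  have hj : j + 1 < n := by omega
  have hk : j + 1 + 1 < n := by omega
  rw [sgen_pos hj, sgen_pos hk]
  rw [Equiv.swap_mul_swap_mul_swap (by simp) (by simp; omega),
    Equiv.swap_comm (⟨j, Nat.lt_of_succ_lt hj⟩ : Fin n) ⟨j + 1, hj⟩,
    Equiv.swap_comm (⟨j + 1, hj⟩ : Fin n) ⟨j + 1 + 1, hk⟩,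
    Equiv.swap_mul_swap_mul_swap (by simp) (by simp; omega), Equiv.swap_comm]

theorem matsumoto (n : ℕ) : ∀ (k : ℕ) (l l' : List ℕ), Red n l → Red n l' → l.length = k →
    wordProd n l = wordProd n l' → TofWord n l = TofWord n l' := by
  intro k
  induction k with
  | zero =>
    intro l l' h h' hk e
    have hk' : l'.length = 0 := by rw [← h'.2, ← e, h.2, hk]
    rw [List.length_eq_zero_iff] at hk hk'
    rw [hk, hk']
  | succ k ih =>
    intro l l' h h' hk e
    have hk' : l'.length = k + 1 := by rw [← h'.2, ← e, h.2, hk]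
    obtain _ | ⟨a, m⟩ := l
    · simp at hk
    obtain _ | ⟨b, m'⟩ := l'
    · simp at hk'
    simp only [List.length_cons, Nat.add_right_cancel_iff] at hk hk'
    wlog hab : a ≤ b generalizing a b m m'
    · exact (this b m' h' a m h e.symm hk' hk (by omega)).symm
    obtain ⟨ha, hm, had⟩ := red_cons h
    obtain ⟨hb, hm', hbd⟩ := red_cons h'
    rw [TofWord_cons, TofWord_cons]
    rcases hab.eq_or_lt with rfl | hab
    · rw [wordProd_cons, wordProd_cons] at e
      rw [ih m m' hm hm' hk (mul_left_cancel e)]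
    have em : wordProd n m = sgen n a * wordProd n (a :: m) := by
      rw [wordProd_cons, sgen_mul_cancel]
    have em' : wordProd n m' = sgen n b * wordProd n (a :: m) := by
      rw [e, wordProd_cons, sgen_mul_cancel]
    have ew := h.2
    generalize wordProd n (a :: m) = w at *
    rw [em, mul_inv_rev, sgen_inv] at had
    rw [em', mul_inv_rev, sgen_inv] at hbd
    simp only [Equiv.Perm.mul_apply, sgen_l, sgen_r, ha, hb] at had hbd
    set f := w⁻¹ with hf
    rcases (show a + 1 ≤ b from hab).eq_or_lt with rfl | hab
    · obtain ⟨p, hp, hpw⟩ := exists_red n _ (sgen n a * (sgen n (a + 1) * (sgen n a * w))) rfl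
      have hinv : (wordProd n p)⁻¹ = f * sgen n a * sgen n (a + 1) * sgen n a := by
        rw [hpw]; simp [sgen_inv, mul_assoc, hf]
      have hinv' : (wordProd n p)⁻¹ = f * sgen n (a + 1) * sgen n a * sgen n (a + 1) := by
        rw [hinv]
        have := sgen_braid (n := n) (j := a) (by omega)
        simp only [mul_assoc] at this ⊢
        rw [this]
      have e1 : sgen n a ⟨a + 1 + 1, hb⟩ = ⟨a + 1 + 1, hb⟩ := sgen_o _ (by simp; omega) (by simp)
      have e2 : sgen n (a + 1) ⟨a, by omega⟩ = ⟨a, by omega⟩ := sgen_o _ (by simp) (by simp; omega)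
      have l1 := sgen_l ha
      have l2 := sgen_l hb
      have r1 := sgen_r ha
      have r2 := sgen_r hb
      have rap : Red n (a :: p) := by
        apply red_cons' ha hp
        rw [hinv]
        simpa [l1, l2, r1, r2, e1, e2] using hbd
      have rbp : Red n ((a + 1) :: p) := by
        apply red_cons' hb hp
        rw [hinv']
        simpa [l1, l2, r1, r2, e1, e2] using had
      have rbap : Red n ((a + 1) :: a :: p) := by
        apply red_cons' hb rap
        rw [wordProd_inv_cons, hinv, mul_sgen_cancel]
        simp only [Equiv.Perm.mul_apply, l1, l2, r1, r2, e1, e2]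
        exact hbd.trans had
      have rabp : Red n (a :: (a + 1) :: p) := by
        apply red_cons' ha rbp
        rw [wordProd_inv_cons, hinv', mul_sgen_cancel]
        simp only [Equiv.Perm.mul_apply, l1, l2, r1, r2, e1, e2]
        exact hbd.trans had
      have w1 : wordProd n m = wordProd n ((a + 1) :: a :: p) := by
        rw [wordProd_cons, wordProd_cons, hpw, sgen_mul_cancel, sgen_mul_cancel, em]
      have w2 : wordProd n m' = wordProd n (a :: (a + 1) :: p) := by
        have := sgen_braid (n := n) (j := a) (by omega)
        rw [wordProd_cons, wordProd_cons, em', ← inv_inj, mul_inv_rev, mul_inv_rev, mul_inv_rev,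
          hinv']
        simp [sgen_inv, mul_sgen_cancel, hf]
      rw [ih m _ hm rbap hk w1, ih m' _ hm' rabp hk' w2]
      simp only [TofWord_cons, ← mul_assoc]
      rw [Tg_braid (by omega)]
    · obtain ⟨p, hp, hpw⟩ := exists_red n _ (sgen n b * (sgen n a * w)) rfl
      have hc := sgen_comm hab hb
      have hinv : (wordProd n p)⁻¹ = f * sgen n a * sgen n b := by
        rw [hpw]; simp [sgen_inv, hf]
      have hinv' : (wordProd n p)⁻¹ = f * sgen n b * sgen n a := by
        rw [hinv, mul_assoc, hc, mul_assoc]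
      have l1 := sgen_l ha
      have l2 := sgen_l hb
      have r1 := sgen_r ha
      have r2 := sgen_r hb
      have e1 : sgen n a ⟨b, by omega⟩ = ⟨b, by omega⟩ := sgen_o _ (by simp; omega) (by simp; omega)
      have e2 : sgen n a ⟨b + 1, hb⟩ = ⟨b + 1, hb⟩ := sgen_o _ (by simp; omega) (by simp; omega)
      have e3 : sgen n b ⟨a, by omega⟩ = ⟨a, by omega⟩ := sgen_o _ (by simp; omega) (by simp; omega)
      have e4 : sgen n b ⟨a + 1, ha⟩ = ⟨a + 1, ha⟩ := sgen_o _ (by simp; omega) (by simp; omega)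
      have rap : Red n (a :: p) := by
        apply red_cons' ha hp
        rw [hinv']
        simpa [l1, l2, r1, r2, e1, e2, e3, e4] using had
      have rbp : Red n (b :: p) := by
        apply red_cons' hb hp
        rw [hinv]
        simpa [l1, l2, r1, r2, e1, e2, e3, e4] using hbd
      have w1 : wordProd n m = wordProd n (b :: p) := by
        rw [wordProd_cons, hpw, sgen_mul_cancel, em]
      have w2 : wordProd n m' = wordProd n (a :: p) := by
        rw [wordProd_cons, em', ← inv_inj, mul_inv_rev, mul_inv_rev, hinv']
        simp [sgen_inv, mul_sgen_cancel, hf]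
      rw [ih m _ hm rbp hk w1, ih m' _ hm' rap hk' w2]
      simp only [TofWord_cons, ← mul_assoc]
      rw [Tg_comm hab hb]

lemma Tw_of_red {n : ℕ} {l : List ℕ} (hl : Red n l) : Tw n (wordProd n l) = TofWord n l := by
  obtain ⟨h1, h2⟩ := redWord_spec n (wordProd n l)
  exact matsumoto n _ _ _ h1 hl rfl h2

lemma Tw_mul_Tg {n j : ℕ} (h : j + 1 < n) (w : Equiv.Perm (Fin n))
    (hw : w ⟨j, Nat.lt_of_succ_lt h⟩ < w ⟨j + 1, h⟩) :
    Tw n (w * sgen n j) = Tw n w * Tg n j := by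
  obtain ⟨h1, h2⟩ := redWord_spec n w
  have e : wordProd n (redWord n w ++ [j]) = w * sgen n j := by
    conv_rhs => rw [← h2]
    simp [wordProd]
  have hr : Red n (redWord n w ++ [j]) := by
    refine ⟨?_, ?_⟩
    · intro i hi
      rcases List.mem_append.mp hi with hi | hi
      · exact h1.1 i hi
      · rw [List.mem_singleton] at hi
        omega
    · rw [e, ninv_inv, ninv_up h w hw, List.length_append, ← h1.2, h2, ninv_inv]
      simp
  rw [← e, Tw_of_red hr]
  simp [TofWord, Tw]

lemma Tw_one (n : ℕ) : Tw n 1 = 1 := by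
  have : Tw n (wordProd n []) = TofWord n [] := Tw_of_red ⟨by simp, by simp [wordProd, ninv_one]⟩
  simpa [wordProd, TofWord] using this

/-- `t⁻¹` -/
def tinv : HR := LaurentPolynomial.T (-1)

lemma tinv_mul : tinv * tt = 1 := by
  rw [tinv, tt, ← LaurentPolynomial.T_add]
  simp

lemma tt_mul : tt * tinv = 1 := by rw [mul_comm, tinv_mul]

section JM

variable {K : Type*} [Ring K] [Algebra HR K]

/-- Jucys–Murphy elements -/
def JM (A : ℕ → K) : ℕ → K
  | 0 => 1
  | k + 1 => tinv • (A k * JM A k * A k)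

/-- inverses of generators -/
def AInv (A : ℕ → K) (k : ℕ) : K := tinv • (A k + (1 - tt) • (1 : K))

/-- inverses of Jucys–Murphy elements -/
def JMi (A : ℕ → K) : ℕ → K
  | 0 => 1
  | k + 1 => tt • (AInv A k * JMi A k * AInv A k)

variable {n : ℕ} {A : ℕ → K}
  (quad : ∀ j, j + 1 < n → A j * A j = (tt - 1) • A j + algebraMap HR K tt)
  (braid : ∀ j, j + 2 < n → A j * A (j + 1) * A j = A (j + 1) * A j * A (j + 1))
  (comm : ∀ j k, j + 1 < k → k + 1 < n → A j * A k = A k * A j)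

include quad in
lemma A_mul_AInv {j : ℕ} (h : j + 1 < n) : A j * AInv A j = 1 := by
  have e : A j * AInv A j = tinv • (A j * A j + (1 - tt) • A j) := by
    simp [AInv, mul_add]
  rw [e, quad j h, Algebra.algebraMap_eq_smul_one]
  have : (tt - 1) • A j + tt • (1 : K) + (1 - tt) • A j = tt • (1 : K) := by module
  rw [this, smul_smul, tinv_mul, one_smul]

include quad in
lemma AInv_mul_A {j : ℕ} (h : j + 1 < n) : AInv A j * A j = 1 := by
  rw [← A_mul_AInv quad h]
  simp [AInv, mul_add, add_mul]

include quad in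
lemma JM_mul_JMi (i : ℕ) (hi : i < n) : JM A i * JMi A i = 1 ∧ JMi A i * JM A i = 1 := by
  induction i with
  | zero => simp [JM, JMi]
  | succ k ih =>
    obtain ⟨h1, h2⟩ := ih (by omega)
    have a1 := A_mul_AInv quad hi
    have a2 := AInv_mul_A quad hi
    constructor
    · rw [JM, JMi, smul_mul_smul_comm, tinv_mul, one_smul]
      calc _ = A k * JM A k * (A k * AInv A k) * JMi A k * AInv A k := by simp only [mul_assoc]
        _ = A k * (JM A k * JMi A k) * AInv A k := by rw [a1]; simp only [mul_assoc, one_mul]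
        _ = 1 := by rw [h1, mul_one, a1]
    · rw [JM, JMi, smul_mul_smul_comm, tt_mul, one_smul]
      calc _ = AInv A k * JMi A k * (AInv A k * A k) * JM A k * A k := by simp only [mul_assoc]
        _ = AInv A k * (JMi A k * JM A k) * A k := by rw [a2]; simp only [mul_assoc, one_mul]
        _ = 1 := by rw [h2, mul_one, a2]

include comm in
lemma JM_comm_hi (i j : ℕ) (hij : i < j) (hj : j + 1 < n) : Commute (A j) (JM A i) := by
  induction i with
  | zero => exact Commute.one_right _
  | succ k ih =>
    have c : Commute (A j) (A k) := (comm k j (by omega) hj).symm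
    rw [JM]
    exact ((c.mul_right (ih (by omega))).mul_right c).smul_right _

include braid comm in
lemma JM_comm_lo (i j : ℕ) (hij : j + 2 ≤ i) (hi : i < n) : Commute (A j) (JM A i) := by
  induction i with
  | zero => omega
  | succ k ih =>
    rcases (show j + 1 ≤ k by omega).eq_or_lt with rfl | h
    · rw [JM, JM]
      have c : A (j + 1) * JM A j = JM A j * A (j + 1) := JM_comm_hi comm j (j + 1) (by omega) hi
      have b := braid j hi
      rw [mul_smul_comm, smul_mul_assoc, smul_smul]
      apply Commute.smul_right
      show A j * _ = _ * A j
      calc A j * (A (j + 1) * (A j * JM A j * A j) * A (j + 1))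
          = (A j * A (j + 1) * A j) * JM A j * A j * A (j + 1) := by simp only [mul_assoc]
        _ = A (j + 1) * A j * (A (j + 1) * JM A j) * A j * A (j + 1) := by
          rw [b]; simp only [mul_assoc]
        _ = A (j + 1) * A j * JM A j * (A (j + 1) * A j * A (j + 1)) := by
          rw [c]; simp only [mul_assoc]
        _ = _ := by rw [← b]; simp only [mul_assoc]
    · have c : Commute (A j) (A k) := comm j k h hi
      rw [JM]
      exact ((c.mul_right (ih (by omega) (by omega))).mul_right c).smul_right _

include braid comm in
lemma JM_comm_JM (i k : ℕ) (hik : i < k) (hk : k < n) : Commute (JM A i) (JM A k) := by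
  induction i with
  | zero => exact Commute.one_left _
  | succ i ih =>
    have c := JM_comm_lo braid comm k i (by omega) hk
    rw [JM]
    exact ((c.mul_left (ih (by omega))).mul_left c).smul_left _

include quad braid comm in
theorem exists_hom (junk : ∀ j, ¬ j + 1 < n → A j = 1) :
    ∃ ρ : H n →ₐ[HR] K, ∀ j, ρ (Tg n j) = A j := by
  let φ : FA n →ₐ[HR] K := FreeAlgebra.lift HR fun g => match g with
    | AGen.T j => A j
    | AGen.X i => JM A i
    | AGen.Xinv i => JMi A i
  have hT : ∀ j, φ (fT n j) = A j := fun j => by simp [φ, fT]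
  have hX : ∀ i, φ (fX n i) = JM A i := fun j => by simp [φ, fX]
  have hXi : ∀ i, φ (fXi n i) = JMi A i := fun j => by simp [φ, fXi]
  have hrel : ∀ ⦃x y : FA n⦄, ARel n x y → φ x = φ y := by
    intro x y hxy
    cases hxy with
    | junk j h => rw [hT, junk j h, map_one]
    | quad j h => rw [map_mul, map_add, map_smul, hT, quad j h, AlgHom.commutes]
    | braid j h => simp only [map_mul, hT]; exact braid j h
    | commT j k h1 h2 => simp only [map_mul, hT]; exact comm j k h1 h2
    | commX i i' =>
      simp only [map_mul, hX]
      rcases lt_trichotomy (i : ℕ) i' with h | h | h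
      · exact JM_comm_JM braid comm _ _ h i'.2
      · rw [h]
      · exact (JM_comm_JM braid comm _ _ h i.2).symm
    | XinvL i => rw [map_mul, hX, hXi, (JM_mul_JMi quad i i.2).1, map_one]
    | XinvR i => rw [map_mul, hX, hXi, (JM_mul_JMi quad i i.2).2, map_one]
    | TXT j h =>
      simp only [map_mul, map_smul, hT, hX]
      rw [JM, smul_smul, tt_mul, one_smul]
    | TXcomm j h i h1 h2 =>
      simp only [map_mul, hT, hX]
      rcases lt_or_gt_of_ne h1 with h3 | h3
      · exact JM_comm_hi comm _ _ h3 h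
      · exact JM_comm_lo braid comm _ _ (by omega) i.2
  refine ⟨RingQuot.liftAlgHom HR ⟨φ, hrel⟩, fun j => ?_⟩
  rw [Tg, RingQuot.liftAlgHom_mkAlgHom_apply, hT]

end JM

/-- the regular representation -/
def regA (n j : ℕ) : Module.End HR (Equiv.Perm (Fin n) →₀ HR) :=
  if h : j + 1 < n then
    Finsupp.lift _ HR _ fun w =>
      if w⁻¹ ⟨j, Nat.lt_of_succ_lt h⟩ < w⁻¹ ⟨j + 1, h⟩ then Finsupp.single (sgen n j * w) 1
      else (tt - 1) • Finsupp.single w 1 + tt • Finsupp.single (sgen n j * w) 1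
  else 1

lemma regA_up {n j : ℕ} (h : j + 1 < n) (w : Equiv.Perm (Fin n))
    (hw : w⁻¹ ⟨j, Nat.lt_of_succ_lt h⟩ < w⁻¹ ⟨j + 1, h⟩) :
    regA n j (Finsupp.single w 1) = Finsupp.single (sgen n j * w) 1 := by
  rw [regA, dif_pos h]
  simp only [Finsupp.lift_apply]
  rw [Finsupp.sum_single_index (by simp), if_pos hw, one_smul]

lemma regA_down {n j : ℕ} (h : j + 1 < n) (w : Equiv.Perm (Fin n))
    (hw : w⁻¹ ⟨j + 1, h⟩ < w⁻¹ ⟨j, Nat.lt_of_succ_lt h⟩) :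
    regA n j (Finsupp.single w 1) =
      (tt - 1) • Finsupp.single w 1 + tt • Finsupp.single (sgen n j * w) 1 := by
  rw [regA, dif_pos h]
  simp only [Finsupp.lift_apply]
  rw [Finsupp.sum_single_index (by simp), if_neg hw.not_gt, one_smul]

lemma end_ext {n : ℕ} {f g : Module.End HR (Equiv.Perm (Fin n) →₀ HR)}
    (h : ∀ w, f (Finsupp.single w 1) = g (Finsupp.single w 1)) : f = g :=
  Finsupp.lhom_ext' fun w => LinearMap.ext_ring (h w)

lemma inv_sgen_mul {n j : ℕ} (w : Equiv.Perm (Fin n)) (x : Fin n) :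
    (sgen n j * w)⁻¹ x = w⁻¹ (sgen n j x) := by
  rw [mul_inv_rev, sgen_inv, Equiv.Perm.mul_apply]

lemma regA_quad {n j : ℕ} (h : j + 1 < n) :
    regA n j * regA n j = (tt - 1) • regA n j + algebraMap HR _ tt := by
  apply end_ext
  intro w
  simp only [Module.End.mul_apply, LinearMap.add_apply, LinearMap.smul_apply,
    Module.algebraMap_end_apply]
  rcases ne_adj h w⁻¹ with h1 | h1
  · rw [regA_down h w h1, map_add, map_smul, map_smul, regA_down h w h1,
      regA_up h (sgen n j * w) (by simpa only [inv_sgen_mul, sgen_l h, sgen_r h] using h1),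
      sgen_mul_cancel]
  · rw [regA_up h w h1,
      regA_down h (sgen n j * w) (by simpa only [inv_sgen_mul, sgen_l h, sgen_r h] using h1),
      sgen_mul_cancel]

lemma regA_comm {n j k : ℕ} (hjk : j + 1 < k) (hk : k + 1 < n) :
    regA n j * regA n k = regA n k * regA n j := by
  have hj : j + 1 < n := by omega
  have e1 : sgen n j ⟨k, by omega⟩ = ⟨k, by omega⟩ := sgen_o _ (by simp; omega) (by simp; omega)
  have e2 : sgen n j ⟨k + 1, hk⟩ = ⟨k + 1, hk⟩ := sgen_o _ (by simp; omega) (by simp; omega)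
  have e3 : sgen n k ⟨j, by omega⟩ = ⟨j, by omega⟩ := sgen_o _ (by simp; omega) (by simp; omega)
  have e4 : sgen n k ⟨j + 1, hj⟩ = ⟨j + 1, hj⟩ := sgen_o _ (by simp; omega) (by simp; omega)
  apply end_ext
  intro w
  have hc : sgen n j * (sgen n k * w) = sgen n k * (sgen n j * w) := by
    rw [← mul_assoc, sgen_comm hjk hk, mul_assoc]
  simp only [Module.End.mul_apply]
  rcases ne_adj hj w⁻¹ with h1 | h1 <;> rcases ne_adj hk w⁻¹ with h2 | h2
  · have h1' : (sgen n k * w)⁻¹ ⟨j + 1, hj⟩ < (sgen n k * w)⁻¹ ⟨j, Nat.lt_of_succ_lt hj⟩ := by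
      simpa only [inv_sgen_mul, e3, e4] using h1
    have h2' : (sgen n j * w)⁻¹ ⟨k + 1, hk⟩ < (sgen n j * w)⁻¹ ⟨k, Nat.lt_of_succ_lt hk⟩ := by
      simpa only [inv_sgen_mul, e1, e2] using h2
    rw [regA_down hj w h1, regA_down hk w h2]
    simp only [map_add, map_smul]
    rw [regA_down hj w h1, regA_down hk w h2, regA_down hj _ h1', regA_down hk _ h2', hc]
    module
  · have h1' : (sgen n k * w)⁻¹ ⟨j + 1, hj⟩ < (sgen n k * w)⁻¹ ⟨j, Nat.lt_of_succ_lt hj⟩ := by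
      simpa only [inv_sgen_mul, e3, e4] using h1
    have h2' : (sgen n j * w)⁻¹ ⟨k, Nat.lt_of_succ_lt hk⟩ < (sgen n j * w)⁻¹ ⟨k + 1, hk⟩ := by
      simpa only [inv_sgen_mul, e1, e2] using h2
    rw [regA_down hj w h1, regA_up hk w h2]
    simp only [map_add, map_smul]
    rw [regA_up hk w h2, regA_down hj _ h1', regA_up hk _ h2', hc]
  · have h1' : (sgen n k * w)⁻¹ ⟨j, Nat.lt_of_succ_lt hj⟩ < (sgen n k * w)⁻¹ ⟨j + 1, hj⟩ := by
      simpa only [inv_sgen_mul, e3, e4] using h1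
    have h2' : (sgen n j * w)⁻¹ ⟨k + 1, hk⟩ < (sgen n j * w)⁻¹ ⟨k, Nat.lt_of_succ_lt hk⟩ := by
      simpa only [inv_sgen_mul, e1, e2] using h2
    rw [regA_up hj w h1, regA_down hk w h2]
    simp only [map_add, map_smul]
    rw [regA_up hj w h1, regA_up hj _ h1', regA_down hk _ h2', hc]
  · have h1' : (sgen n k * w)⁻¹ ⟨j, Nat.lt_of_succ_lt hj⟩ < (sgen n k * w)⁻¹ ⟨j + 1, hj⟩ := by
      simpa only [inv_sgen_mul, e3, e4] using h1
    have h2' : (sgen n j * w)⁻¹ ⟨k, Nat.lt_of_succ_lt hk⟩ < (sgen n j * w)⁻¹ ⟨k + 1, hk⟩ := by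
      simpa only [inv_sgen_mul, e1, e2] using h2
    rw [regA_up hj w h1, regA_up hk w h2, regA_up hj _ h1', regA_up hk _ h2', hc]

lemma regA_if {n j : ℕ} (h : j + 1 < n) (w : Equiv.Perm (Fin n)) :
    regA n j (Finsupp.single w 1) =
      if w⁻¹ ⟨j, Nat.lt_of_succ_lt h⟩ < w⁻¹ ⟨j + 1, h⟩ then Finsupp.single (sgen n j * w) 1
      else (tt - 1) • Finsupp.single w 1 + tt • Finsupp.single (sgen n j * w) 1 := by
  rcases ne_adj h w⁻¹ with h1 | h1
  · rw [regA_down h w h1, if_neg h1.not_gt]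
  · rw [regA_up h w h1, if_pos h1]

lemma regA_braid {n j : ℕ} (h : j + 2 < n) :
    regA n j * regA n (j + 1) * regA n j = regA n (j + 1) * regA n j * regA n (j + 1) := by
  have ha : j + 1 < n := by omega
  have hb : j + 1 + 1 < n := by omega
  have l1 := sgen_l ha
  have l2 := sgen_l hb
  have r1 := sgen_r ha
  have r2 := sgen_r hb
  have e1 : sgen n j ⟨j + 1 + 1, hb⟩ = ⟨j + 1 + 1, hb⟩ := sgen_o _ (by simp; omega) (by simp)
  have e2 : sgen n (j + 1) ⟨j, by omega⟩ = ⟨j, by omega⟩ := sgen_o _ (by simp) (by simp; omega)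
  apply end_ext
  intro w
  have hc : sgen n j * (sgen n (j + 1) * (sgen n j * w)) =
      sgen n (j + 1) * (sgen n j * (sgen n (j + 1) * w)) := by
    have := sgen_braid h
    simp only [← mul_assoc]
    rw [this]
  simp only [Module.End.mul_apply]
  have h1 := ne_adj ha w⁻¹
  have h2 := ne_adj hb w⁻¹
  have h3 : w⁻¹ ⟨j, by omega⟩ < w⁻¹ ⟨j + 1 + 1, hb⟩ ∨
      w⁻¹ ⟨j + 1 + 1, hb⟩ < w⁻¹ ⟨j, by omega⟩ := by
    apply lt_or_gt_of_ne
    intro e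
    have := w⁻¹.injective e
    simp at this
    omega
  rcases h1 with h1 | h1 <;> rcases h2 with h2 | h2 <;> rcases h3 with h3 | h3 <;>
  first
  | (exfalso; exact absurd (h1.trans h3) h2.not_gt)
  | (exfalso; exact absurd (h2.trans h1) h3.not_gt)
  | (exfalso; exact absurd (h1.trans h2) h3.not_gt)
  | (simp only [regA_if ha, regA_if hb, map_add, map_smul, inv_sgen_mul, l1, l2, r1, r2, e1, e2,
      h1, h2, h3, h1.not_gt, h2.not_gt, h3.not_gt, if_true, if_false, sgen_mul_cancel, hc]
     try module)

theorem exists_phi (n : ℕ) : ∃ φ : H n →ₗ[HR] (Equiv.Perm (Fin n) →₀ HR),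
    ∀ w, φ (Tw n w) = Finsupp.single w 1 := by
  obtain ⟨ρ, hρ⟩ := exists_hom (n := n) (A := regA n) (fun j h => regA_quad h)
    (fun j h => regA_braid h) (fun j k h1 h2 => regA_comm h1 h2) (fun j h => by rw [regA, dif_neg h])
  refine ⟨(LinearMap.applyₗ (Finsupp.single 1 1)).comp ρ.toLinearMap, fun w => ?_⟩
  have key : ∀ l, Red n l →
      ρ (TofWord n l) (Finsupp.single 1 1) = Finsupp.single (wordProd n l) 1 := by
    intro l
    induction l with
    | nil => intro _; simp [TofWord, wordProd]
    | cons j l ih =>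
      intro hr
      obtain ⟨h, hl, hd⟩ := red_cons hr
      rw [TofWord_cons, map_mul, Module.End.mul_apply, ih hl, hρ, regA_up h _ hd, wordProd_cons]
  obtain ⟨h1, h2⟩ := redWord_spec n w
  have := key _ h1
  rw [h2] at this
  simpa [Tw] using this

lemma app_inv' {n : ℕ} (w : Equiv.Perm (Fin n)) (x : Fin n) : w (w⁻¹ x) = x :=
  w.apply_symm_apply x

lemma inv_app' {n : ℕ} (w : Equiv.Perm (Fin n)) (x : Fin n) : w⁻¹ (w x) = x :=
  w.symm_apply_apply x

lemma colPerm_lt {n : ℕ} (C : Finset (Fin n)) (i : Fin n) (h : (i : ℕ) < C.card) :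
    colPerm n C i = C.orderEmbOfFin rfl ⟨i, h⟩ := by
  have e : (finCongr ((Nat.add_sub_cancel' (col_card_le n C)).symm)) i =
      Fin.castAdd _ ⟨i, h⟩ := Fin.ext rfl
  simp only [colPerm, Equiv.trans_apply]
  rw [e, finSumFinEquiv_symm_apply_castAdd]
  simp

lemma colPerm_ge {n : ℕ} (C : Finset (Fin n)) (i : Fin n) (h : C.card ≤ (i : ℕ)) :
    colPerm n C i = Cᶜ.orderEmbOfFin (by simp [Finset.card_compl])
      (⟨i - C.card, by omega⟩ : Fin (n - C.card)) := by
  have e : (finCongr ((Nat.add_sub_cancel' (col_card_le n C)).symm)) i =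
      Fin.natAdd _ (⟨i - C.card, by omega⟩ : Fin (n - C.card)) := Fin.ext (by simp; omega)
  simp only [colPerm, Equiv.trans_apply]
  rw [e, finSumFinEquiv_symm_apply_natAdd]
  simp

lemma colPerm_mem {n : ℕ} (C : Finset (Fin n)) (i : Fin n) :
    colPerm n C i ∈ C ↔ (i : ℕ) < C.card := by
  by_cases h : (i : ℕ) < C.card
  · rw [colPerm_lt C i h]
    simp [h]
  · rw [colPerm_ge C i (by omega)]
    simp only [h, iff_false]
    rw [← Finset.mem_compl]
    exact Finset.orderEmbOfFin_mem _ _ _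

lemma colPerm_mono {n : ℕ} (C : Finset (Fin n)) (i k : Fin n) (hik : i < k)
    (hb : (i : ℕ) < C.card ↔ (k : ℕ) < C.card) : colPerm n C i < colPerm n C k := by
  by_cases h : (i : ℕ) < C.card
  · rw [colPerm_lt C i h, colPerm_lt C k (hb.mp h)]
    simpa using hik
  · rw [colPerm_ge C i (by omega), colPerm_ge C k (by omega)]
    simp only [OrderEmbedding.lt_iff_lt, Fin.lt_def] at hik ⊢
    omega

lemma wAct_iff {n : ℕ} (w : Equiv.Perm (Fin n)) (μ : Fin n → ℤ) :
    wAct n w μ = μ ↔ ∀ i, μ (w i) = μ i := by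
  constructor
  · intro h i
    have := congrFun h (w i)
    simpa [wAct] using this.symm
  · intro h
    funext i
    have := h (w⁻¹ i)
    simpa [wAct] using this.symm

lemma varpi_iff {n ℓ : ℕ} (w : Equiv.Perm (Fin n)) :
    wAct n w (varpi n ℓ) = varpi n ℓ ↔ ∀ i, ((w i : ℕ) < ℓ ↔ (i : ℕ) < ℓ) := by
  rw [wAct_iff]
  apply forall_congr'
  intro i
  unfold varpi
  by_cases h1 : (w i : ℕ) < ℓ <;> by_cases h2 : (i : ℕ) < ℓ <;> simp [h1, h2]

lemma Tw_mul_para {n ℓ : ℕ} (u : Equiv.Perm (Fin n))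
    (hu : ∀ i k : Fin n, i < k → ((i : ℕ) < ℓ ↔ (k : ℕ) < ℓ) → u i < u k) :
    ∀ (N : ℕ) (v : Equiv.Perm (Fin n)), ninv n v = N → (∀ i, ((v i : ℕ) < ℓ ↔ (i : ℕ) < ℓ)) →
      Tw n (u * v) = Tw n u * Tw n v := by
  intro N
  induction N with
  | zero =>
    intro v hv _
    by_cases h1 : v = 1
    · rw [h1, mul_one, Tw_one, mul_one]
    · obtain ⟨j, h, hd⟩ := exists_descent v h1
      have := ninv_down h v hd
      omega
  | succ N ih =>
    intro v hv hs
    have h1 : v ≠ 1 := by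
      rintro rfl
      rw [ninv_one] at hv
      omega
    obtain ⟨j, h, hd⟩ := exists_descent v h1
    have hn := ninv_down h v hd
    have hj : j < ℓ ↔ j + 1 < ℓ := by
      have a := hs ⟨j, by omega⟩
      have b := hs ⟨j + 1, h⟩
      simp only [Fin.lt_def] at hd a b
      omega
    have hsj : ∀ i : Fin n, ((sgen n j i : ℕ) < ℓ ↔ (i : ℕ) < ℓ) := by
      intro i
      by_cases h1 : (i : ℕ) = j
      · have : i = ⟨j, Nat.lt_of_succ_lt h⟩ := Fin.ext h1
        rw [this, sgen_l h]
        exact hj.symm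
      by_cases h2 : (i : ℕ) = j + 1
      · have : i = ⟨j + 1, h⟩ := Fin.ext h2
        rw [this, sgen_r h]
        exact hj
      · rw [sgen_o i h1 h2]
    have hs' : ∀ i, (((v * sgen n j) i : ℕ) < ℓ ↔ (i : ℕ) < ℓ) := fun i => by
      rw [Equiv.Perm.mul_apply, hs, hsj]
    have hup : (v * sgen n j) ⟨j, Nat.lt_of_succ_lt h⟩ < (v * sgen n j) ⟨j + 1, h⟩ := by
      simpa [sgen_l h, sgen_r h] using hd
    have e1 := Tw_mul_Tg h (v * sgen n j) hup
    have e2 := Tw_mul_Tg h (u * (v * sgen n j)) (by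
      apply hu _ _ hup
      rw [hs', hs']
      exact hj)
    rw [mul_sgen_cancel] at e1
    rw [mul_assoc, mul_sgen_cancel] at e2
    rw [e1, e2, ih _ (by omega) hs', mul_assoc]

/-- `w` maps `[ℓ]` onto `E` -/
def PC (n ℓ : ℕ) (E : Finset (Fin n)) (w : Equiv.Perm (Fin n)) : Prop :=
  ∀ i, (w i ∈ E ↔ (i : ℕ) < ℓ)

lemma PC_iff {n : ℕ} (E : Finset (Fin n)) (w : Equiv.Perm (Fin n)) :
    PC n E.card E w ↔ ∀ i, ((((colPerm n E)⁻¹ * w) i : ℕ) < E.card ↔ (i : ℕ) < E.card) := by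
  unfold PC
  apply forall_congr'
  intro i
  rw [← colPerm_mem E, ← colPerm_mem E, Equiv.Perm.mul_apply, app_inv']

lemma PC_unique {n ℓ : ℕ} {E E' : Finset (Fin n)} {w : Equiv.Perm (Fin n)}
    (h : PC n ℓ E w) (h' : PC n ℓ E' w) : E = E' := by
  ext x
  have a := h (w⁻¹ x)
  have b := h' (w⁻¹ x)
  rw [app_inv'] at a b
  rw [a, b]

lemma PC_exists {n : ℕ} (C : Finset (Fin n)) (w : Equiv.Perm (Fin n)) :
    ∃ E : Finset (Fin n), E.card = C.card ∧ PC n C.card E w := by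
  refine ⟨C.map (w * (colPerm n C)⁻¹).toEmbedding, by simp, fun i => ?_⟩
  rw [Finset.mem_map_equiv, ← colPerm_mem C i]
  have : (Equiv.symm (w * (colPerm n C)⁻¹)) (w i) = colPerm n C i := by
    rw [Equiv.symm_apply_eq]
    simp
  rw [this]

/-- projection onto the coefficient of `T_{u_E}` -/
def piE (n : ℕ) (E : Finset (Fin n)) : (Equiv.Perm (Fin n) →₀ HR) →ₗ[HR] H n :=
  Finsupp.lift _ HR _ fun w => if PC n E.card E w then Tw n ((colPerm n E)⁻¹ * w) else 0

lemma piE_single {n : ℕ} (E : Finset (Fin n)) (w : Equiv.Perm (Fin n)) :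
    piE n E (Finsupp.single w 1) =
      if PC n E.card E w then Tw n ((colPerm n E)⁻¹ * w) else 0 := by
  simp only [piE, Finsupp.lift_apply]
  rw [Finsupp.sum_single_index (by simp), one_smul]

lemma piE_phi {n : ℕ} (φ : H n →ₗ[HR] (Equiv.Perm (Fin n) →₀ HR))
    (hφ : ∀ w, φ (Tw n w) = Finsupp.single w 1) (E E' : Finset (Fin n)) (hE : E'.card = E.card)
    (g : H n) (hg : g ∈ HparaM n (varpi n E.card)) :
    piE n E (φ (Tw n (colPerm n E') * g)) = if E' = E then g else 0 := by
  unfold HparaM at hg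
  induction hg using Submodule.span_induction with
  | zero => simp
  | add x y _ _ hx hy =>
    rw [mul_add, map_add, map_add, hx, hy]
    split_ifs <;> simp
  | smul a x _ hx =>
    rw [mul_smul_comm, map_smul, map_smul, hx]
    split_ifs <;> simp
  | mem x hx =>
    obtain ⟨v, hv, rfl⟩ := hx
    have hv' := (varpi_iff v).mp hv
    rw [← Tw_mul_para (ℓ := E.card) (colPerm n E')
      (fun i k hik hb => colPerm_mono E' i k hik (by rw [hE]; exact hb)) _ v rfl hv', hφ, piE_single]
    have hP : PC n E.card E' (colPerm n E' * v) := by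
      rw [← hE, PC_iff]
      intro i
      rw [inv_mul_cancel_left, hE]
      exact hv' i
    by_cases h : E' = E
    · subst h
      rw [if_pos hP, if_pos rfl, inv_mul_cancel_left]
    · rw [if_neg h, if_neg]
      intro h'
      exact h (PC_unique hP h')

lemma paraCoeff_sum {n : ℕ} (C : Finset (Fin n)) (s : Finset (Equiv.Perm (Fin n))) :
    paraCoeff n C.card (∑ w ∈ s, Tw n w) C =
      ∑ w ∈ s, if PC n C.card C w then Tw n ((colPerm n C)⁻¹ * w) else 0 := by
  obtain ⟨φ, hφ⟩ := exists_phi n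
  have hpi : ∀ E, piE n E (φ (∑ w ∈ s, Tw n w)) =
      ∑ w ∈ s, if PC n E.card E w then Tw n ((colPerm n E)⁻¹ * w) else 0 := by
    intro E
    rw [map_sum, map_sum]
    exact Finset.sum_congr rfl fun w _ => by rw [hφ, piE_single]
  have hex : ∃ g : Finset (Fin n) → H n,
      (∀ F : Finset (Fin n), F.card = C.card → g F ∈ HparaM n (varpi n C.card)) ∧
      (∑ w ∈ s, Tw n w) = ∑ F ∈ colFinset n C.card, Tw n (colPerm n F) * g F := by
    refine ⟨fun E => ∑ w ∈ s, if PC n E.card E w then Tw n ((colPerm n E)⁻¹ * w) else 0, ?_, ?_⟩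
    · intro F hF
      apply Submodule.sum_mem
      intro w _
      split_ifs with h
      · apply Submodule.subset_span
        refine ⟨_, ?_, rfl⟩
        rw [Set.mem_setOf_eq, varpi_iff, ← hF]
        exact (PC_iff F w).mp h
      · exact Submodule.zero_mem _
    · simp only [Finset.mul_sum]
      rw [Finset.sum_comm]
      apply Finset.sum_congr rfl
      intro w _
      obtain ⟨E, hE, hP⟩ := PC_exists C w
      rw [Finset.sum_eq_single E]
      · rw [← hE] at hP
        rw [if_pos hP, ← Tw_mul_para (ℓ := E.card) (colPerm n E) (colPerm_mono E) _ _ rfl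
          ((PC_iff E w).mp hP), mul_inv_cancel_left]
      · intro F hF hne
        have hF' : F.card = C.card := by simpa [colFinset] using hF
        rw [if_neg, mul_zero]
        intro h
        rw [hF'] at h
        exact hne (PC_unique h hP)
      · intro h
        exact absurd (by simp [colFinset, hE]) h
  rw [← hpi]
  have e : paraCoeff n C.card (∑ w ∈ s, Tw n w) C = hex.choose C := by
    unfold paraCoeff
    rw [dif_pos hex]
  obtain ⟨h1, h2⟩ := hex.choose_spec
  rw [e]
  generalize hex.choose = g at h1 h2 ⊢
  rw [h2, map_sum, map_sum, Finset.sum_eq_single C]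
  · rw [piE_phi φ hφ C C rfl _ (h1 C rfl), if_pos rfl]
  · intro F hF hne
    have hF' : F.card = C.card := by simpa [colFinset] using hF
    rw [piE_phi φ hφ C F hF' _ (h1 F hF'), if_neg hne]
  · intro h
    exact absurd (by simp [colFinset]) h

lemma lt_shapeColLen {n : ℕ} {μ : Fin n → ℤ} (hμ : Antitone μ) (j : ℕ) (i : Fin n) :
    (i : ℕ) < shapeColLen n μ j ↔ (j : ℤ) < μ i := by
  unfold shapeColLen
  constructor
  · intro h
    by_contra hc
    have : (Finset.univ.filter fun k : Fin n => (j : ℤ) < μ k) ⊆ Finset.Iio i := by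
      intro k hk
      simp only [Finset.mem_filter, Finset.mem_univ, true_and] at hk
      rw [Finset.mem_Iio]
      by_contra hki
      exact hc (hk.trans_le (hμ (not_lt.mp hki)))
    have := Finset.card_le_card this
    simp only [Fin.card_Iio] at this
    omega
  · intro h
    have : Finset.Iic i ⊆ (Finset.univ.filter fun k : Fin n => (j : ℤ) < μ k) := by
      intro k hk
      simp only [Finset.mem_filter, Finset.mem_univ, true_and]
      exact h.trans_le (hμ (Finset.mem_Iic.mp hk))
    have := Finset.card_le_card this
    simp only [Fin.card_Iic] at this
    omega

lemma colPerm_fix {n m : ℕ} (F : Finset (Fin n)) (hm : m ≤ F.card)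
    (hF : ∀ i : Fin n, (i : ℕ) < m → i ∈ F) :
    ∀ (N : ℕ) (i : Fin n), (i : ℕ) = N → (i : ℕ) < m → colPerm n F i = i := by
  intro N
  induction N using Nat.strong_induction_on with
  | _ N ih =>
    intro i hN hi
    obtain ⟨k, hk⟩ := (colPerm n F).surjective i
    have hkF : (k : ℕ) < F.card := by
      rw [← colPerm_mem F, hk]
      exact hF i hi
    rcases lt_trichotomy k i with h | h | h
    · have := ih k (by rw [← hN]; exact h) k rfl (lt_trans h hi)
      rw [hk] at this
      exact absurd this h.ne'
    · rw [h] at hk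
      exact hk
    · have h1 := colPerm_mono F i k h (by simp only [hkF, iff_true]; omega)
      rw [hk] at h1
      have h2 := ih _ (by rw [← hN]; exact h1) (colPerm n F i) rfl (lt_trans h1 hi)
      exact (colPerm n F).injective h2

lemma core {n : ℕ} {μ : Fin n → ℤ} (hμ : Antitone μ) (h0 : ∀ i, 0 ≤ μ i) (F : Finset (Fin n))
    (hm : shapeColLen n μ 0 ≤ F.card) (hF : ∀ i : Fin n, (i : ℕ) < shapeColLen n μ 0 → i ∈ F) :
    paraCoeff n F.card (onePara n μ) F = onePara n (fun i => varpi n F.card i + μ i) := by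
  have hpos : ∀ i : Fin n, (i : ℕ) < shapeColLen n μ 0 ↔ 0 < μ i := fun i => by
    simpa using lt_shapeColLen hμ 0 i
  have hzero : ∀ i : Fin n, ¬ (i : ℕ) < shapeColLen n μ 0 → μ i = 0 := fun i hi => by
    rw [hpos] at hi
    exact le_antisymm (not_lt.mp hi) (h0 i)
  have hfix := fun i => colPerm_fix F hm hF _ i rfl
  have hinv : ∀ i, μ (colPerm n F i) = μ i := by
    intro i
    by_cases hi : (i : ℕ) < shapeColLen n μ 0
    · rw [hfix i hi]
    · rw [hzero i hi]
      apply hzero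
      intro hc
      have := (colPerm n F).injective (hfix _ hc)
      rw [this] at hc
      exact hi hc
  rw [onePara, paraCoeff_sum, onePara, ← Finset.sum_filter]
  apply Finset.sum_equiv (Equiv.mulLeft (colPerm n F)⁻¹)
  · intro w
    obtain ⟨v, rfl⟩ : ∃ v, w = colPerm n F * v := ⟨(colPerm n F)⁻¹ * w, by simp⟩
    simp only [Finset.mem_filter, stabFinset, Finset.mem_univ, true_and, PC_iff,
      Equiv.coe_mulLeft, inv_mul_cancel_left, wAct_iff, Equiv.Perm.mul_apply, inv_app', hinv]
    constructor
    · rintro ⟨h1, h2⟩ i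
      have := (varpi_iff v).mpr h2
      rw [wAct_iff] at this
      rw [this, h1]
    · intro h
      have h2 : ∀ i, ((v i : ℕ) < F.card ↔ (i : ℕ) < F.card) := by
        intro i
        have := h i
        have a1 := h0 i
        have a2 := h0 (v i)
        have a3 := hzero i
        have a4 := hzero (v i)
        unfold varpi at this
        split_ifs at this <;> omega
      refine ⟨fun i => ?_, h2⟩
      have := h i
      have h3 := (varpi_iff v).mpr h2
      rw [wAct_iff] at h3
      rw [h3] at this
      omega
  · intro w _
    rfl

lemma numCols_le {n : ℕ} {μ : Fin n → ℤ} (i : Fin n) : (μ i).toNat ≤ numCols n μ :=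
  Finset.le_sup (f := fun i : Fin n => (μ i).toNat) (Finset.mem_univ i)

lemma core2 {n : ℕ} {μ : Fin n → ℤ} (hμ : Antitone μ) (h0 : ∀ i, 0 ≤ μ i) (F : Finset (Fin n))
    (hm : shapeColLen n μ 0 ≤ F.card) (hF : ∀ i : Fin n, (i : ℕ) < shapeColLen n μ 0 → i ∈ F)
    (hP : Psi n (hwTableau n μ) = onePara n μ) :
    Psi n (F :: hwTableau n μ)
          = tpow n (len n (colPerm n F)) * Ring.inverse (Tw n (colPerm n F)⁻¹) *
              onePara n (fun i => varpi n F.card i + μ i) := by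
  rw [← core hμ h0 F hm hF, ← hP]
  rcases hT : hwTableau n μ with _ | ⟨C, S⟩
  · have hN : numCols n μ = 0 := by
      have := congrArg List.length hT
      simpa [hwTableau] using this
    have hz : ∀ i, μ i = 0 := fun i => by
      have := numCols_le (μ := μ) i
      have := h0 i
      omega
    have hP' : Psi n [] = onePara n μ := by rw [← hT]; exact hP
    rw [hP', core hμ h0 F hm hF]
    simp only [hz, add_zero]
    rfl
  · rfl

lemma card_hwCol {n m : ℕ} (h : m ≤ n) : (hwCol n m).card = m := by
  have : hwCol n m = Finset.univ.map (Fin.castLEEmb h) := by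
    ext x
    simp only [hwCol, Finset.mem_filter, Finset.mem_univ, true_and, Finset.mem_map]
    constructor
    · intro hx
      exact ⟨⟨x, hx⟩, Fin.ext rfl⟩
    · rintro ⟨y, rfl⟩
      exact y.2
  rw [this, Finset.card_map, Finset.card_univ, Fintype.card_fin]

lemma nth_eq {n : ℕ} (C : Finset (Fin n)) (k : ℕ) (hk : k < C.card) :
    nth n C k = (C.orderEmbOfFin rfl ⟨k, hk⟩ : ℕ) := by
  unfold nth
  rw [List.getD_eq_getElem _ _ (by simpa using hk), Finset.orderEmbOfFin_apply, List.getElem_map]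
  rfl

lemma nth_hwCol {n m : ℕ} (h : m ≤ n) (k : ℕ) (hk : k < m) : nth n (hwCol n m) k = k := by
  have hc := card_hwCol h
  rw [nth_eq _ k (by omega)]
  have := Finset.orderEmbOfFin_unique (s := hwCol n m) rfl
    (f := fun i : Fin (hwCol n m).card => (⟨i, by have := i.2; omega⟩ : Fin n))
    (fun i => by have := i.2; simp [hwCol]; omega) (fun a b hab => hab)
  rw [← this]

lemma le_orderEmb {n : ℕ} (C : Finset (Fin n)) : ∀ (k : ℕ) (hk : k < C.card),
    k ≤ (C.orderEmbOfFin rfl ⟨k, hk⟩ : ℕ) := by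
  intro k
  induction k with
  | zero => intro _; exact Nat.zero_le _
  | succ k ih =>
    intro hk
    have h1 := ih (by omega)
    have h2 : C.orderEmbOfFin rfl ⟨k, by omega⟩ < C.orderEmbOfFin rfl ⟨k + 1, hk⟩ := by
      simp
    rw [Fin.lt_def] at h2
    omega

lemma shapeColLen_le {n : ℕ} (μ : Fin n → ℤ) (j : ℕ) : shapeColLen n μ j ≤ n :=
  col_card_le n _

lemma mem_of_pairSS {n m : ℕ} (h : m ≤ n) (F : Finset (Fin n)) (hm : m ≤ F.card)
    (hp : pairSS n F (hwCol n m)) (i : Fin n) (hi : (i : ℕ) < m) : i ∈ F := by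
  have h1 := hp i (by rw [card_hwCol h]; exact hi)
  rw [nth_hwCol h _ hi, nth_eq F _ (by omega)] at h1
  have h2 := le_orderEmb F i (by omega)
  have h3 : F.orderEmbOfFin rfl ⟨i, by omega⟩ = i := Fin.ext (le_antisymm h1 h2)
  rw [← h3]
  exact Finset.orderEmbOfFin_mem _ _ _

lemma colPerm_hwCol {n m : ℕ} (h : m ≤ n) : colPerm n (hwCol n m) = 1 := by
  have hc := card_hwCol h
  apply eq_one_of_no_descent
  intro j hj
  by_cases hb : j < m ↔ j + 1 < m
  · apply colPerm_mono
    · simp [Fin.lt_def]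
    · rw [hc]; exact hb
  · have a := colPerm_mem (hwCol n m) ⟨j, by omega⟩
    have b := colPerm_mem (hwCol n m) ⟨j + 1, hj⟩
    simp only [hc] at a b
    simp only [hwCol, Finset.mem_filter, Finset.mem_univ, true_and] at a b
    simp only [hwCol, Fin.lt_def]
    omega

lemma hwTableau_succ {n N : ℕ} {μ : Fin n → ℤ} (hN : numCols n μ = N + 1) :
    numCols n (fun i => max (μ i - 1) 0) = N ∧
    hwTableau n μ = hwCol n (shapeColLen n μ 0) :: hwTableau n (fun i => max (μ i - 1) 0) := by
  have h1 : numCols n (fun i => max (μ i - 1) 0) = N := by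
    apply le_antisymm
    · apply Finset.sup_le
      intro i _
      have := numCols_le (μ := μ) i
      dsimp only
      omega
    · have : numCols n μ ≤ numCols n (fun i => max (μ i - 1) 0) + 1 := by
        apply Finset.sup_le
        intro i _
        have := numCols_le (μ := fun i => max (μ i - 1) 0) i
        try dsimp only at this
        omega
      omega
  refine ⟨h1, ?_⟩
  have hs : ∀ j : ℕ, shapeColLen n (fun i => max (μ i - 1) 0) j = shapeColLen n μ (j + 1) := by
    intro j
    unfold shapeColLen
    congr 1
    ext i
    simp only [Finset.mem_filter, Finset.mem_univ, true_and]
    push_cast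
    omega
  apply List.ext_getElem
  · simp [hwTableau, hN, h1]
  · intro k hk hk'
    cases k with
    | zero => simp [hwTableau]
    | succ k => simp [hwTableau, hs]

theorem part2 (n : ℕ) : ∀ (N : ℕ) (lam : Fin n → ℤ), numCols n lam = N → Antitone lam →
    (∀ i, 0 ≤ lam i) → Psi n (hwTableau n lam) = onePara n lam := by
  intro N
  induction N with
  | zero =>
    intro lam hN _ h0
    have hz : ∀ i, lam i = 0 := fun i => by
      have := numCols_le (μ := lam) i
      have := h0 i
      omega
    have : hwTableau n lam = [] := by
      apply List.eq_nil_of_length_eq_zero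
      simp [hwTableau, hN]
    rw [this]
    show one0 n = _
    rw [one0, onePara]
    congr 1
    ext w
    simp [stabFinset, wAct_iff, hz]
  | succ N ih =>
    intro lam hN ha h0
    obtain ⟨h1, h2⟩ := hwTableau_succ hN
    set μ : Fin n → ℤ := fun i => max (lam i - 1) 0 with hμ
    have hμa : Antitone μ := fun i k hik => by
      have := ha hik
      simp only [hμ]
      omega
    have hμ0 : ∀ i, 0 ≤ μ i := fun i => by simp [hμ]
    have hle := shapeColLen_le lam 0
    have hcard := card_hwCol hle
    have hsub : ∀ i : Fin n, (i : ℕ) < shapeColLen n μ 0 → (i : ℕ) < shapeColLen n lam 0 := by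
      intro i
      rw [lt_shapeColLen hμa, lt_shapeColLen ha]
      simp only [hμ]
      intro h
      push_cast at h ⊢
      omega
    have hm : shapeColLen n μ 0 ≤ (hwCol n (shapeColLen n lam 0)).card := by
      rw [hcard]
      by_contra hc
      have := hsub ⟨shapeColLen n lam 0, by have := shapeColLen_le μ 0; omega⟩ (by simpa using hc)
      simp at this
    rw [h2, core2 hμa hμ0 _ hm (fun i hi => by simpa [hwCol] using hsub i hi) (ih μ h1 hμa hμ0),
      colPerm_hwCol hle, inv_one, Tw_one, Ring.inverse_one, len_eq, inv_one, ninv_one, hcard]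
    have e : (fun i => varpi n (shapeColLen n lam 0) i + μ i) = lam := by
      funext i
      have := lt_shapeColLen ha 0 i
      have := h0 i
      simp only [varpi, hμ]
      split_ifs <;> push_cast at * <;> omega
    rw [e]
    simp [tpow]

/-- if `F ⊗ T⁰_μ` is semistandard with `|F| = ℓ ≥ ℓ(μ)`, then
`Ψ_{F ⊗ T⁰_μ} = t^{ℓ(u_F)} (T_{u_F⁻¹})⁻¹ 1_{ϖ_ℓ + μ}`; in particular
`Ψ_{T⁰_λ} = 1_λ` for every dominant `λ ∈ ℤⁿ_{≥0}`. -/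
theorem stmt13 (n : ℕ) (hn : 1 ≤ n) :
    (∀ μ : Fin n → ℤ, Antitone μ → (∀ i, 0 ≤ μ i) →
      ∀ F : Finset (Fin n), 1 ≤ F.card → shapeColLen n μ 0 ≤ F.card →
        isSSYT n (F :: hwTableau n μ) →
        Psi n (F :: hwTableau n μ)
          = tpow n (len n (colPerm n F)) * Ring.inverse (Tw n (colPerm n F)⁻¹) *
              onePara n (fun i => varpi n F.card i + μ i))
    ∧ (∀ lam : Fin n → ℤ, Antitone lam → (∀ i, 0 ≤ lam i) →
        Psi n (hwTableau n lam) = onePara n lam) := by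
  refine ⟨?_, fun lam ha h0 => part2 n _ lam rfl ha h0⟩
  intro μ hμ h0 F _ hm hss
  refine core2 hμ h0 F hm ?_ (part2 n _ μ rfl hμ h0)
  intro i hi
  rcases hN : numCols n μ with _ | N
  · have h1 := (lt_shapeColLen hμ 0 i).mp hi
    have h2 := numCols_le (μ := μ) i
    push_cast at h1
    omega
  · rw [(hwTableau_succ hN).2] at hss
    have hp : pairSS n F (hwCol n (shapeColLen n μ 0)) :=
      (List.isChain_cons_cons.mp hss).1
    exact mem_of_pairSS (shapeColLen_le μ 0) F hm hp i hi

end HLHecke
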